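/- For every nonempty class F of sequential experts, every t ∈ {0,…,T}, and all sequences x_{1:t} ∈ X^t, y_{1:t} ∈ Y^t, the dual value-to-go equals the worst-case log contextual Shtarkov sum with prefix: W(F, x_{1:t}, y_{1:t}) = sup_x log S_T(F, x | x_{1:t}, y_{1:t}), the supremum being over all context trees x of depth T−t (equality in the extended reals). -/

import Mathlib

open scoped BigOperators

/-- The probability simplex on a finite label set `Y`. -/
abbrev Simplex (Y : Type*) [Fintype Y] :=
  {p : Y → ℝ // (∀ y, 0 ≤ p y) ∧ ∑ y, p y = 1}

/-- A sequential expert: given contexts `x₁,…,x_t` (a list of length `t`) and past labels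
`y₁,…,y_{t-1}` (a list of length `t-1`), it predicts a distribution over labels. -/
abbrev Expert (X Y : Type*) [Fintype Y] := List X → List Y → Simplex Y

/-- `-log x` as an extended real, with `-log 0 = ⊤` (and junk value `⊤` for `x < 0`). -/
noncomputable def negLog (x : ℝ) : EReal :=
  if x ≤ 0 then ⊤ else ((-Real.log x : ℝ) : EReal)

/-- `log x` as an extended real, with `log 0 = ⊥` (and junk value `⊥` for `x < 0`). -/
noncomputable def elog (x : ℝ) : EReal :=
  if x ≤ 0 then ⊥ else ((Real.log x : ℝ) : EReal)

/-- The logarithmic loss `ℓ(p, y) = -log p(y) ∈ [0, ∞]`. -/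
noncomputable def logloss {Y : Type*} [Fintype Y] (p : Simplex Y) (y : Y) : EReal :=
  negLog (p.1 y)

/-- Likelihood of expert `f` on a context sequence `xs` and a label sequence `ys`
of the same length: `L(f; y_{1:d} | x_{1:d}) = ∏_{t=1}^d f(x_{1:t}, y_{1:t-1})(y_t)`. -/
noncomputable def likelihood {X Y : Type*} [Fintype Y] [Inhabited Y]
    (f : Expert X Y) (xs : List X) (ys : List Y) : ℝ :=
  ∏ t ∈ Finset.range ys.length, (f (xs.take (t + 1)) (ys.take t)).1 (ys.getD t default)

/-- Cumulative log loss of expert `f` on `xs`, `ys`: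
`Σ_{t=1}^d ℓ(f(x_{1:t}, y_{1:t-1}), y_t)`. -/
noncomputable def cumLoss {X Y : Type*} [Fintype Y] [Inhabited Y]
    (f : Expert X Y) (xs : List X) (ys : List Y) : EReal :=
  ∑ t ∈ Finset.range ys.length, logloss (f (xs.take (t + 1)) (ys.take t)) (ys.getD t default)

/-- A context tree of depth `T` is modelled as a map `χ : List Y → X` (only its values on
lists of length `< T` matter): `x_t(y) = χ (y_{1:t-1})`.  `treePath χ ys` is the context
sequence `x(y) = (x_1, x_2(y_1), …)` obtained by tracing the tree along the path `ys`. -/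
def treePath {X Y : Type*} (χ : List Y → X) (ys : List Y) : List X :=
  (List.range ys.length).map fun t => χ (ys.take t)

/-- The contextual Shtarkov sum of `F` on a context tree `χ` of depth `r`, with prefix
`xs ∈ X^t`, `ys ∈ Y^t`:
`S_T(F, χ | x_{1:t}, y_{1:t}) = Σ_{y ∈ Y^r} sup_{f ∈ F} L(f; (y_{1:t}, y) | (x_{1:t}, χ(y)))`. -/
noncomputable def shtarkovPrefix {X Y : Type*} [Fintype Y] [Inhabited Y]
    (F : Set (Expert X Y)) (r : ℕ) (χ : List Y → X) (xs : List X) (ys : List Y) : ℝ :=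
  ∑ y : Fin r → Y, ⨆ f : F,
    likelihood (f : Expert X Y) (xs ++ treePath χ (List.ofFn y)) (ys ++ List.ofFn y)

/-- The contextual Shtarkov sum `S_T(F | χ) = Σ_{y ∈ Y^T} sup_{f ∈ F} L(f; y | χ(y))`. -/
noncomputable def shtarkov {X Y : Type*} [Fintype Y] [Inhabited Y]
    (F : Set (Expert X Y)) (T : ℕ) (χ : List Y → X) : ℝ :=
  shtarkovPrefix F T χ [] []

/-- The extensive-form game value with `r` rounds to go, given past contexts `xs`, past
labels `ys`, and accumulated learner loss `acc`:
`sup_{x} inf_{p̂} sup_{y} ⋯ [ acc + Σ ℓ(p̂_s, y_s) − inf_{f ∈ F} Σ_{s=1}^T ℓ(f, y_s) ]`. -/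
noncomputable def valToGo {X Y : Type*} [Fintype Y] [Inhabited Y]
    (F : Set (Expert X Y)) : ℕ → List X → List Y → EReal → EReal
  | 0, xs, ys, acc => acc - ⨅ f : F, cumLoss (f : Expert X Y) xs ys
  | r + 1, xs, ys, acc =>
      ⨆ x : X, ⨅ p : Simplex Y, ⨆ y : Y,
        valToGo F r (xs ++ [x]) (ys ++ [y]) (acc + logloss p y)

/-- The minimax regret
`R_T(F) = sup_{x_1} inf_{p̂_1} sup_{y_1} ⋯ sup_{x_T} inf_{p̂_T} sup_{y_T} R_T(F; p̂, x, y)`. -/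
noncomputable def minimaxRegret {X Y : Type*} [Fintype Y] [Inhabited Y]
    (F : Set (Expert X Y)) (T : ℕ) : EReal :=
  valToGo F T [] [] 0

/-- Nested conditional expectation over a probabilistic tree `π`, for `r` remaining rounds:
`E_{y_1 ∼ π([])} E_{y_2 ∼ π(y_{1:1})} ⋯ [g(y_{1:r})]`. -/
noncomputable def expTree {Y : Type*} [Fintype Y] (π : List Y → Simplex Y)
    (g : List Y → EReal) : ℕ → List Y → EReal
  | 0, pre => g pre
  | r + 1, pre => ∑ y : Y, ((π pre).1 y : EReal) * expTree π g r (pre ++ [y])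

/-- The dual (max-min) value-to-go `W(F, x_{1:t}, y_{1:t})`: the supremum over context trees
`χ` and probabilistic trees `π` of depth `r = T - t` of
`E_{y∼π}[ Σ_{s=t+1}^T ℓ(π_s(y), y_s) − inf_{f ∈ F} Σ_{s=1}^T ℓ(f, y_s) ]`. -/
noncomputable def dualValToGo {X Y : Type*} [Fintype Y] [Inhabited Y]
    (F : Set (Expert X Y)) (r : ℕ) (xs : List X) (ys : List Y) : EReal :=
  ⨆ χ : List Y → X, ⨆ π : List Y → Simplex Y,
    expTree π (fun suf =>
      (∑ s ∈ Finset.range r, logloss (π (suf.take s)) (suf.getD s default)) -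
        ⨅ f : F, cumLoss (f : Expert X Y) (xs ++ treePath χ suf) (ys ++ suf)) r []

/-- The dual (max-min) value `V_T(F)`. -/
noncomputable def dualValue {X Y : Type*} [Fintype Y] [Inhabited Y]
    (F : Set (Expert X Y)) (T : ℕ) : EReal :=
  dualValToGo F T [] []

section LogEReal

theorem elog_of_pos {x : ℝ} (hx : 0 < x) : elog x = (Real.log x : EReal) := if_neg hx.not_ge

theorem elog_of_nonpos {x : ℝ} (hx : x ≤ 0) : elog x = ⊥ := if_pos hx

theorem negLog_of_pos {x : ℝ} (hx : 0 < x) : negLog x = ((-Real.log x : ℝ) : EReal) :=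
  if_neg hx.not_ge

theorem negLog_of_nonpos {x : ℝ} (hx : x ≤ 0) : negLog x = ⊤ := if_pos hx

theorem neg_negLog (x : ℝ) : -negLog x = elog x := by
  rcases le_or_gt x 0 with hx | hx
  · simp [negLog_of_nonpos hx, elog_of_nonpos hx]
  · simp [negLog_of_pos hx, elog_of_pos hx]

theorem negLog_mul {a b : ℝ} (ha : 0 ≤ a) (hb : 0 ≤ b) :
    negLog (a * b) = negLog a + negLog b := by
  rcases ha.eq_or_lt with rfl | ha
  · rw [zero_mul, negLog_of_nonpos le_rfl]
    rcases le_or_gt b 0 with hb | hb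
    · simp [negLog_of_nonpos hb]
    · rw [negLog_of_pos hb, EReal.top_add_coe]
  rcases hb.eq_or_lt with rfl | hb
  · rw [mul_zero, negLog_of_nonpos le_rfl, negLog_of_pos ha, EReal.coe_add_top]
  · rw [negLog_of_pos ha, negLog_of_pos hb, negLog_of_pos (mul_pos ha hb),
      Real.log_mul ha.ne' hb.ne', ← EReal.coe_add]
    congr 1
    ring

theorem negLog_prod {ι : Type*} (s : Finset ι) (a : ι → ℝ) (ha : ∀ i, 0 ≤ a i) :
    negLog (∏ i ∈ s, a i) = ∑ i ∈ s, negLog (a i) := by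
  classical
  induction s using Finset.induction_on with
  | empty => simp [negLog_of_pos one_pos]
  | insert i s hi ih =>
    rw [Finset.prod_insert hi, Finset.sum_insert hi,
      negLog_mul (ha i) (Finset.prod_nonneg fun j _ => ha j), ih]

theorem elog_le_coe_iff {x b : ℝ} : elog x ≤ (b : EReal) ↔ x ≤ Real.exp b := by
  rcases le_or_gt x 0 with hx | hx
  · simp [elog_of_nonpos hx, hx.trans (Real.exp_pos b).le]
  · rw [elog_of_pos hx, EReal.coe_le_coe_iff, Real.log_le_iff_le_exp hx]

theorem elog_le_bot_iff {x : ℝ} : elog x ≤ ⊥ ↔ x ≤ 0 := by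
  rcases le_or_gt x 0 with hx | hx
  · simp [elog_of_nonpos hx, hx]
  · simp [elog_of_pos hx, hx.not_ge]

theorem elog_mono : Monotone elog := by
  intro x y hxy
  rcases le_or_gt x 0 with hx | hx
  · simp [elog_of_nonpos hx]
  · rw [elog_of_pos hx, elog_of_pos (hx.trans_le hxy), EReal.coe_le_coe_iff]
    exact Real.log_le_log hx hxy

theorem elog_iSup {ι : Type*} [Nonempty ι] {a : ι → ℝ} (ha : BddAbove (Set.range a)) :
    elog (⨆ i, a i) = ⨆ i, elog (a i) := by
  refine le_antisymm ?_ (iSup_le fun i => elog_mono (le_ciSup ha i))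
  have h : ∀ i, elog (a i) ≤ ⨆ i, elog (a i) := le_iSup fun i => elog (a i)
  generalize (⨆ i, elog (a i)) = b at h
  induction b with
  | bot => exact elog_le_bot_iff.2 (ciSup_le fun i => elog_le_bot_iff.1 (h i))
  | top => exact le_top
  | coe b => exact elog_le_coe_iff.2 (ciSup_le fun i => elog_le_coe_iff.1 (h i))

theorem EReal.neg_iInf_eq_iSup_neg {ι : Sort*} (a : ι → EReal) : -(⨅ i, a i) = ⨆ i, -a i :=
  EReal.negOrderIso.map_iInf a

end LogEReal

section Likelihood

variable {X Y : Type*} [Fintype Y]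

theorem Simplex.nonneg (p : Simplex Y) (y : Y) : 0 ≤ p.1 y := p.2.1 y

theorem Simplex.le_one (p : Simplex Y) (y : Y) : p.1 y ≤ 1 :=
  (Finset.single_le_sum (fun z _ => p.2.1 z) (Finset.mem_univ y)).trans_eq p.2.2

variable [Inhabited Y]

theorem likelihood_nonneg (f : Expert X Y) (xs : List X) (ys : List Y) :
    0 ≤ likelihood f xs ys :=
  Finset.prod_nonneg fun _ _ => Simplex.nonneg _ _

theorem likelihood_le_one (f : Expert X Y) (xs : List X) (ys : List Y) :
    likelihood f xs ys ≤ 1 :=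
  Finset.prod_le_one (fun _ _ => Simplex.nonneg _ _) fun _ _ => Simplex.le_one _ _

theorem cumLoss_eq_negLog_likelihood (f : Expert X Y) (xs : List X) (ys : List Y) :
    cumLoss f xs ys = negLog (likelihood f xs ys) :=
  (negLog_prod _ _ fun _ => Simplex.nonneg _ _).symm

theorem neg_iInf_cumLoss (F : Set (Expert X Y)) (hF : F.Nonempty) (xs : List X) (ys : List Y) :
    -(⨅ f : F, cumLoss (f : Expert X Y) xs ys) =
      elog (⨆ f : F, likelihood (f : Expert X Y) xs ys) := by
  have := hF.to_subtype
  rw [EReal.neg_iInf_eq_iSup_neg, elog_iSup]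
  · simp only [cumLoss_eq_negLog_likelihood, neg_negLog]
  · exact ⟨1, Set.forall_mem_range.2 fun f => likelihood_le_one _ _ _⟩

end Likelihood

section Gibbs

variable {Y : Type*} [Fintype Y]

theorem Simplex.sum_pos_of_pos (p : Simplex Y) (v : Y → ℝ) (hv : ∀ y, 0 ≤ v y)
    (hpv : ∀ y, 0 < p.1 y → 0 < v y) : 0 < ∑ y, v y := by
  obtain ⟨y, -, hy⟩ : ∃ y ∈ Finset.univ, 0 < p.1 y := by
    by_contra! h
    exact absurd (Finset.sum_nonpos h) (by rw [p.2.2]; norm_num)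
  exact Finset.sum_pos' (fun z _ => hv z) ⟨y, Finset.mem_univ y, hpv y hy⟩

/-- Gibbs' inequality, for unnormalized nonnegative weights. -/
theorem sum_mul_log_sub_log_le (p : Simplex Y) (v : Y → ℝ) (hv : ∀ y, 0 ≤ v y)
    (hpv : ∀ y, 0 < p.1 y → 0 < v y) :
    ∑ y, p.1 y * (Real.log (v y) - Real.log (p.1 y)) ≤ Real.log (∑ y, v y) := by
  set S := ∑ y, v y
  have hS : 0 < S := p.sum_pos_of_pos v hv hpv
  have key : ∀ y, p.1 y * (Real.log (v y) - Real.log (p.1 y)) ≤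
      p.1 y * Real.log S + (v y / S - p.1 y) := by
    intro y
    rcases (p.nonneg y).eq_or_lt with hp | hp
    · simp only [← hp, zero_mul, sub_zero, zero_add]
      exact div_nonneg (hv y) hS.le
    · have hvy := hpv y hp
      have h := Real.log_le_sub_one_of_pos (div_pos hvy (mul_pos hp hS))
      rw [Real.log_div hvy.ne' (mul_pos hp hS).ne', Real.log_mul hp.ne' hS.ne'] at h
      have h' := mul_le_mul_of_nonneg_left h hp.le
      have h'' : p.1 y * (v y / (p.1 y * S) - 1) = v y / S - p.1 y := by
        field_simp
      linarith
  refine (Finset.sum_le_sum fun y _ => key y).trans_eq ?_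
  rw [Finset.sum_add_distrib, Finset.sum_sub_distrib, ← Finset.sum_mul, ← Finset.sum_div, p.2.2,
    div_self hS.ne']
  ring

theorem EReal.sum_eq_bot {ι : Type*} {s : Finset ι} {a : ι → EReal} {i : ι} (hi : i ∈ s)
    (h : a i = ⊥) : ∑ j ∈ s, a j = ⊥ := by
  classical
  rw [← Finset.add_sum_erase s a hi, h, EReal.bot_add]

theorem EReal.coe_finset_sum' {ι : Type*} (s : Finset ι) (a : ι → ℝ) :
    ((∑ i ∈ s, a i : ℝ) : EReal) = ∑ i ∈ s, (a i : EReal) := by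
  classical
  induction s using Finset.induction_on with
  | empty => simp
  | insert i s hi ih => rw [Finset.sum_insert hi, Finset.sum_insert hi, EReal.coe_add, ih]

/-- The one-round form of Gibbs' inequality in the extended reals. -/
theorem sum_coe_mul_le_add_elog (p : Simplex Y) (v : Y → ℝ) (hv : ∀ y, 0 ≤ v y) (c : ℝ)
    (e : Y → EReal)
    (he : ∀ y, 0 < p.1 y → e y ≤ ((c - Real.log (p.1 y) : ℝ) : EReal) + elog (v y)) :
    ∑ y, (p.1 y : EReal) * e y ≤ (c : EReal) + elog (∑ y, v y) := by
  by_cases hpv : ∀ y, 0 < p.1 y → 0 < v y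
  · have hpos : 0 < ∑ y, v y := p.sum_pos_of_pos v hv hpv
    have key : ∀ y, (p.1 y : EReal) * e y ≤
        ((p.1 y * c + p.1 y * (Real.log (v y) - Real.log (p.1 y)) : ℝ) : EReal) := by
      intro y
      rcases (p.nonneg y).eq_or_lt with hp | hp
      · simp [← hp]
      · have h := he y hp
        rw [elog_of_pos (hpv y hp), ← EReal.coe_add] at h
        refine (mul_le_mul_of_nonneg_left h (EReal.coe_nonneg.2 hp.le)).trans_eq ?_
        rw [← EReal.coe_mul]
        congr 1
        ring
    refine (Finset.sum_le_sum fun y _ => key y).trans ?_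
    rw [← EReal.coe_finset_sum', elog_of_pos hpos, ← EReal.coe_add, EReal.coe_le_coe_iff,
      Finset.sum_add_distrib, ← Finset.sum_mul, p.2.2, one_mul]
    gcongr
    exact sum_mul_log_sub_log_le p v hv hpv
  · push Not at hpv
    obtain ⟨y, hp, hvy⟩ := hpv
    have h := he y hp
    rw [elog_of_nonpos hvy, EReal.add_bot, le_bot_iff] at h
    rw [EReal.sum_eq_bot (Finset.mem_univ y)]
    · exact bot_le
    · rw [h, EReal.coe_mul_bot_of_pos hp]

/-- Equality holds in Gibbs' inequality at the normalized weights. -/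
theorem sum_coe_mul_eq_add_elog (p : Simplex Y) (v : Y → ℝ) (hv : ∀ y, 0 ≤ v y)
    (hS : 0 < ∑ y, v y) (hp : ∀ y, p.1 y = v y / ∑ z, v z) (c : ℝ) (e : Y → EReal)
    (he : ∀ y, 0 < v y → e y = ((c - Real.log (p.1 y) : ℝ) : EReal) + elog (v y)) :
    ∑ y, (p.1 y : EReal) * e y = (c : EReal) + elog (∑ y, v y) := by
  have key : ∀ y, (p.1 y : EReal) * e y =
      ((p.1 y * (c + Real.log (∑ z, v z)) : ℝ) : EReal) := by
    intro y
    rcases (hv y).eq_or_lt with hvy | hvy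
    · simp [hp y, ← hvy]
    · rw [he y hvy, elog_of_pos hvy, ← EReal.coe_add, ← EReal.coe_mul, hp y,
        Real.log_div hvy.ne' hS.ne']
      congr 1
      ring
  rw [Finset.sum_congr rfl fun y _ => key y, ← EReal.coe_finset_sum', ← Finset.sum_mul, p.2.2,
    one_mul, elog_of_pos hS, EReal.coe_add]

theorem exists_simplex_eq_div_sum [Nonempty (Simplex Y)] (v : Y → ℝ) (hv : ∀ y, 0 ≤ v y) :
    ∃ p : Simplex Y, 0 < ∑ y, v y → ∀ y, p.1 y = v y / ∑ z, v z := by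
  by_cases hS : 0 < ∑ y, v y
  · exact ⟨⟨fun y => v y / ∑ z, v z, fun y => div_nonneg (hv y) hS.le, by
      rw [← Finset.sum_div, div_self hS.ne']⟩, fun _ _ => rfl⟩
  · exact ⟨Classical.arbitrary _, fun h => absurd h hS⟩

end Gibbs

section Tree

variable {Y : Type*} [Fintype Y]

/-- The total weight of the leaves at depth `r` below the node `pre`. -/
def leafSum (A : List Y → ℝ) : ℕ → List Y → ℝ
  | 0, pre => A pre
  | r + 1, pre => ∑ y : Y, leafSum A r (pre ++ [y])

theorem leafSum_nonneg {A : List Y → ℝ} (hA : ∀ l, 0 ≤ A l) (r : ℕ) (pre : List Y) :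
    0 ≤ leafSum A r pre := by
  induction r generalizing pre with
  | zero => exact hA pre
  | succ r ih => exact Finset.sum_nonneg fun y _ => ih _

theorem leafSum_eq_sum_ofFn (A : List Y → ℝ) (r : ℕ) (pre : List Y) :
    leafSum A r pre = ∑ y : Fin r → Y, A (pre ++ List.ofFn y) := by
  induction r generalizing pre with
  | zero => simp [leafSum]
  | succ r ih =>
    simp only [leafSum, ih]
    rw [← Fintype.sum_prod_type', ← (Fin.consEquiv fun _ : Fin (r + 1) => Y).sum_comp]
    refine Finset.sum_congr rfl fun z _ => ?_
    simp [Fin.consEquiv, List.ofFn_succ]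

variable [Inhabited Y]

/-- The cumulative log loss of the probabilistic tree `π` along the path `l`. -/
noncomputable def pathLoss (π : List Y → Simplex Y) (l : List Y) : EReal :=
  ∑ s ∈ Finset.range l.length, logloss (π (l.take s)) (l.getD s default)

theorem pathLoss_append_singleton (π : List Y → Simplex Y) (l : List Y) (y : Y) :
    pathLoss π (l ++ [y]) = pathLoss π l + logloss (π l) y := by
  unfold pathLoss
  rw [List.length_append, List.length_singleton, Finset.sum_range_succ]
  congr 1
  · refine Finset.sum_congr rfl fun s hs => ?_
    have hs := Finset.mem_range.1 hs
    rw [List.take_append_of_le_length hs.le, List.getD_append _ _ _ _ hs]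
  · simp

theorem pathLoss_append_singleton_eq_coe {π : List Y → Simplex Y} {l : List Y} {c : ℝ}
    (hc : pathLoss π l = c) {y : Y} (hy : 0 < (π l).1 y) :
    pathLoss π (l ++ [y]) = ((c - Real.log ((π l).1 y) : ℝ) : EReal) := by
  rw [pathLoss_append_singleton, hc, logloss, negLog_of_pos hy, ← EReal.coe_add, sub_eq_add_neg]

theorem expTree_le_add_elog_leafSum (π : List Y → Simplex Y) {A : List Y → ℝ}
    (hA : ∀ l, 0 ≤ A l) (g : List Y → EReal) (r : ℕ) (pre : List Y)
    (hg : ∀ l : List Y, l.length = pre.length + r → g l = pathLoss π l + elog (A l))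
    (c : ℝ) (hc : pathLoss π pre = c) :
    expTree π g r pre ≤ (c : EReal) + elog (leafSum A r pre) := by
  induction r generalizing pre c with
  | zero => exact (hg pre rfl).trans_le (by rw [hc, leafSum])
  | succ r ih =>
    refine sum_coe_mul_le_add_elog (π pre) _ (fun y => leafSum_nonneg hA _ _) c _ fun y hy => ?_
    refine ih (pre ++ [y]) (fun l hl => hg l ?_) _ (pathLoss_append_singleton_eq_coe hc hy)
    rw [hl, List.length_append, List.length_singleton]
    omega

theorem expTree_eq_add_elog_leafSum (π : List Y → Simplex Y) {A : List Y → ℝ}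
    (hA : ∀ l, 0 ≤ A l) (g : List Y → EReal) (T r : ℕ) (pre : List Y)
    (hT : pre.length + r = T)
    (hg : ∀ l : List Y, l.length = T → g l = pathLoss π l + elog (A l))
    (hπ : ∀ l : List Y, 0 < ∑ y, leafSum A (T - l.length - 1) (l ++ [y]) → ∀ y, (π l).1 y =
      leafSum A (T - l.length - 1) (l ++ [y]) / ∑ z, leafSum A (T - l.length - 1) (l ++ [z]))
    (c : ℝ) (hc : pathLoss π pre = c) (hpos : 0 < leafSum A r pre) :
    expTree π g r pre = (c : EReal) + elog (leafSum A r pre) := by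
  induction r generalizing pre c with
  | zero => exact (hg pre hT).trans (by rw [hc, leafSum])
  | succ r ih =>
    have hr : T - pre.length - 1 = r := by omega
    have hp := hπ pre
    rw [hr] at hp
    replace hp := hp hpos
    refine sum_coe_mul_eq_add_elog (π pre) _ (fun y => leafSum_nonneg hA _ _) hpos hp c _
      fun y hy => ?_
    refine ih (pre ++ [y]) ?_ _ (pathLoss_append_singleton_eq_coe hc ?_) hy
    · rw [List.length_append, List.length_singleton]
      omega
    · rw [hp y]
      exact div_pos hy hpos

theorem iSup_expTree_eq_elog_leafSum [Nonempty (Simplex Y)] {A : List Y → ℝ}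
    (hA : ∀ l, 0 ≤ A l) (r : ℕ) :
    ⨆ π : List Y → Simplex Y, expTree π (fun l =>
      (∑ s ∈ Finset.range r, logloss (π (l.take s)) (l.getD s default)) + elog (A l)) r [] =
      elog (leafSum A r []) := by
  have hg (π : List Y → Simplex Y) (l : List Y) (hl : l.length = r) :
      (∑ s ∈ Finset.range r, logloss (π (l.take s)) (l.getD s default)) + elog (A l) =
        pathLoss π l + elog (A l) := by
    rw [pathLoss, hl]
  have hnil (π : List Y → Simplex Y) : pathLoss π [] = (0 : ℝ) := by simp [pathLoss]
  refine le_antisymm (iSup_le fun π => ?_) ?_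
  · refine (expTree_le_add_elog_leafSum π hA _ r [] (fun l hl => hg π l ?_) 0 (hnil π)).trans_eq ?_
    · simpa using hl
    · simp
  · rcases le_or_gt (leafSum A r []) 0 with h0 | hpos
    · simp [elog_of_nonpos h0]
    · choose π hπ using fun l : List Y => exists_simplex_eq_div_sum
        (fun y => leafSum A (r - l.length - 1) (l ++ [y])) fun y => leafSum_nonneg hA _ _
      refine le_trans (le_of_eq ?_) (le_iSup _ π)
      rw [expTree_eq_add_elog_leafSum π hA _ r r [] (by simp) (hg π) hπ 0 (hnil π) hpos]
      simp

end Tree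

/-- For every nonempty class `F`, every `t ∈ {0,…,T}` and all prefixes
`x_{1:t}`, `y_{1:t}`, the dual value-to-go equals the worst-case log contextual Shtarkov sum
with prefix: `W(F, x_{1:t}, y_{1:t}) = sup_χ log S_T(F, χ | x_{1:t}, y_{1:t})`, supremum over
context trees `χ` of depth `T − t` (equality in the extended reals). -/
theorem dualValToGo_eq_sup_log_shtarkovPrefix
    {X Y : Type*} [Fintype Y] [Inhabited Y] [Nonempty X]
    (F : Set (Expert X Y)) (hF : F.Nonempty) (T t : ℕ) (ht : t ≤ T)
    (xs : List X) (ys : List Y) (hxs : xs.length = t) (hys : ys.length = t) :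
    dualValToGo F (T - t) xs ys =
      ⨆ χ : List Y → X, elog (shtarkovPrefix F (T - t) χ xs ys) := by
  have : Nonempty (Simplex Y) := ⟨hF.some [] []⟩
  refine iSup_congr fun χ => ?_
  rw [shtarkovPrefix]
  simp only [sub_eq_add_neg, neg_iInf_cumLoss F hF]
  rw [iSup_expTree_eq_elog_leafSum fun l => Real.iSup_nonneg fun f => likelihood_nonneg _ _ _,
    leafSum_eq_sum_ofFn]
  simp only [List.nil_append]
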